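/- (Theorem 1, interior case.) Let occ : ℤ³ → S be an occupancy map, let e be an axis direction, let q ∈ ℤ³, and let r ≥ 1 be an integer. Assume that the voxel q + r·e is a boundary interior voxel, and that for every integer i with 0 ≤ i < r the voxel q + i·e is not a boundary voxel (so q + r·e is the nearest boundary voxel to q in direction e, at positive distance r). Then occ(q) = free. -/

import Mathlib

inductive OccState : Type
  | free | occupied | unknown
deriving DecidableEq

abbrev Voxel := ℤ × ℤ × ℤ

/-- Two voxels are 6-neighbors iff their ℓ¹ distance is 1. -/
def sixNbr (m n : Voxel) : Prop :=
  |m.1 - n.1| + |m.2.1 - n.2.1| + |m.2.2 - n.2.2| = 1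

/-- Boundary interior voxel: free, with a 6-neighbor that is unknown or occupied. -/
def bdInt (occ : Voxel → OccState) (n : Voxel) : Prop :=
  occ n = OccState.free ∧
    ∃ m, sixNbr m n ∧ (occ m = OccState.unknown ∨ occ m = OccState.occupied)

/-- Boundary exterior (unknown) voxel: unknown, with a free 6-neighbor. -/
def bdUkn (occ : Voxel → OccState) (n : Voxel) : Prop :=
  occ n = OccState.unknown ∧ ∃ m, sixNbr m n ∧ occ m = OccState.free

/-- Boundary exterior (occupied) voxel: any occupied voxel. -/
def bdOcc (occ : Voxel → OccState) (n : Voxel) : Prop :=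
  occ n = OccState.occupied

/-- Boundary voxel. -/
def bdVoxel (occ : Voxel → OccState) (n : Voxel) : Prop :=
  bdInt occ n ∨ bdUkn occ n ∨ bdOcc occ n

/-- An axis direction: exactly one nonzero coordinate, equal to ±1 (ℓ¹ norm 1). -/
def axisDir (e : Voxel) : Prop :=
  |e.1| + |e.2.1| + |e.2.2| = 1

/-- A non-boundary voxel adjacent to a free voxel is free. -/
theorem occ_eq_free_of_sixNbr {occ : Voxel → OccState} {m n : Voxel}
    (hnm : sixNbr m n) (hm : occ m = OccState.free) (hn : ¬ bdVoxel occ n) :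
    occ n = OccState.free := by
  cases h : occ n with
  | free => rfl
  | occupied => exact (hn (Or.inr (Or.inr h))).elim
  | unknown => exact (hn (Or.inr (Or.inl ⟨h, m, hnm, hm⟩))).elim

theorem sixNbr_add_succ_smul {e : Voxel} (he : axisDir e) (q : Voxel) (i : ℤ) :
    sixNbr (q + (i + 1) • e) (q + i • e) := by
  have h : q + (i + 1) • e - (q + i • e) = e := by
    rw [add_smul, one_smul]
    abel
  change |(q + (i + 1) • e - (q + i • e)).1| + |(q + (i + 1) • e - (q + i • e)).2.1| +
    |(q + (i + 1) • e - (q + i • e)).2.2| = 1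
  rw [h]
  exact he

theorem stmt2 (occ : Voxel → OccState) (e : Voxel) (he : axisDir e)
    (q : Voxel) (r : ℤ) (hr : 1 ≤ r)
    (hb : bdInt occ (q + r • e))
    (hnb : ∀ i : ℤ, 0 ≤ i → i < r → ¬ bdVoxel occ (q + i • e)) :
    occ q = OccState.free := by
  have key : ∀ i : ℤ, i ≤ r → 0 ≤ i → occ (q + i • e) = OccState.free := by
    intro i hi
    induction i, hi using Int.leInductionDown with
    | base => exact fun _ => hb.1
    | pred i hi ih =>
      intro h0
      have hn := sixNbr_add_succ_smul he q (i - 1)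
      rw [sub_add_cancel] at hn
      exact occ_eq_free_of_sixNbr hn (ih (by omega)) (hnb _ h0 (by omega))
  simpa using key 0 (by omega) le_rfl
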